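/- arXiv:0902.2493 — 3 statements merged into one kernel-verified Lean document; each statement's English description precedes it below -/
import Mathlib

section
/- Let G be a finitely generated group, let {h_n : G → A_n * B_n} be a convergent sequence of homomorphisms into free products, and let L be the associated limit group over free products with quotient map η : G → L and set of elliptics E_L. Let H ≤ G be a finitely generated subgroup with η(H) ⊆ E_L. Then for all but finitely many n, the subgroup h_n(H) of A_n * B_n is contained in a conjugate of the canonical image of A_n or of the canonical image of B_n. -/
/-- An element of the free product `X ∗ Y` is *elliptic* if it is conjugate to an element of
the canonical image of `X` or of the canonical image of `Y`. -/
def IsElliptic {X Y : Type*} [Group X] [Group Y] (x : Monoid.Coprod X Y) : Prop :=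
  ∃ c : Monoid.Coprod X Y,
    (∃ a : X, x = c * Monoid.Coprod.inl a * c⁻¹) ∨ (∃ b : Y, x = c * Monoid.Coprod.inr b * c⁻¹)

/-- A sequence of homomorphisms `h n : G →* A n ∗ B n` is *convergent* if every element of `G`
is eventually always trivial or eventually always nontrivial, and eventually always elliptic or
eventually always non-elliptic. -/
def ConvergentSeq {G : Type*} [Group G] {A B : ℕ → Type*}
    [∀ n, Group (A n)] [∀ n, Group (B n)]
    (h : ∀ n, G →* Monoid.Coprod (A n) (B n)) : Prop :=
  (∀ g : G, (∀ᶠ n in Filter.atTop, h n g = 1) ∨ (∀ᶠ n in Filter.atTop, h n g ≠ 1)) ∧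
  (∀ g : G, (∀ᶠ n in Filter.atTop, IsElliptic (h n g)) ∨
    (∀ᶠ n in Filter.atTop, ¬ IsElliptic (h n g)))

namespace Monoid.CoprodI

variable {ι : Type*} {M : ι → Type*} [∀ i, Group (M i)]

namespace NeWord

/-- Splitting off the first letter of a reduced word. -/
theorem exists_prod_eq_of_mul {i j : ι} (w : NeWord M i j) :
    ∃ a : M i, (i = j ∧ w.prod = of a) ∨
      ∃ k, k ≠ i ∧ ∃ w' : NeWord M k j, w.prod = of a * w'.prod := by
  induction w with
  | singleton x hx => exact ⟨x, .inl ⟨rfl, prod_singleton x hx⟩⟩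
  | append w₁ hne w₂ ih₁ ih₂ =>
    obtain ⟨a, ⟨rfl, ha⟩ | ⟨k, hk, w', hw'⟩⟩ := ih₁
    · exact ⟨a, .inr ⟨_, hne.symm, w₂, by rw [append_prod, ha]⟩⟩
    · exact ⟨a, .inr ⟨k, hk, append w' hne w₂, by simp only [append_prod, hw', mul_assoc]⟩⟩

/-- Splitting off the last letter of a reduced word. -/
theorem exists_prod_eq_mul_of {i j : ι} (w : NeWord M i j) :
    ∃ b : M j, (i = j ∧ w.prod = of b) ∨
      ∃ k, k ≠ j ∧ ∃ w' : NeWord M i k, w.prod = w'.prod * of b := by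
  obtain ⟨a, ⟨rfl, ha⟩ | ⟨k, hk, w', hw'⟩⟩ := w.inv.exists_prod_eq_of_mul
  · exact ⟨a⁻¹, .inl ⟨rfl, by rw [map_inv, ← ha, inv_prod, inv_inv]⟩⟩
  · exact ⟨a⁻¹, .inr ⟨k, hk, w'.inv, by
      rw [map_inv, inv_prod, ← mul_inv_rev, ← hw', inv_prod, inv_inv]⟩⟩

theorem toList_eq_of_prod_eq {i j k l : ι} {w : NeWord M i j} {w' : NeWord M k l}
    (h : w.prod = w'.prod) : w.toList = w'.toList := by
  classical
  have : w.toWord = w'.toWord := Word.equiv.symm.injective h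
  exact congrArg Word.toList this

theorem prod_ne_one {i j : ι} (w : NeWord M i j) : w.prod ≠ 1 := by
  classical
  intro h
  have : w.toWord = Word.empty := Word.equiv.symm.injective (h.trans Word.prod_empty.symm)
  exact w.toList_ne_nil (congrArg Word.toList this)

theorem index_eq_of_prod_eq {i j k l : ι} {w : NeWord M i j} {w' : NeWord M k l}
    (h : w.prod = w'.prod) : i = k ∧ j = l := by
  have hl := toList_eq_of_prod_eq h
  have hh := congrArg List.head? hl
  have ht := congrArg List.getLast? hl
  rw [toList_head?, toList_head?] at hh
  rw [toList_getLast?, toList_getLast?] at ht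
  exact ⟨congrArg Sigma.fst (Option.some.inj hh), congrArg Sigma.fst (Option.some.inj ht)⟩

end NeWord

theorem exists_neWord_prod_eq {x : CoprodI M} (hx : x ≠ 1) :
    ∃ (i j : ι) (w : NeWord M i j), w.prod = x := by
  classical
  have hne : Word.equiv x ≠ Word.empty := fun h => hx <| by
    rw [← Word.equiv.symm_apply_apply x, h]
    exact Word.prod_empty
  obtain ⟨i, j, w, hw⟩ := NeWord.of_word _ hne
  refine ⟨i, j, w, ?_⟩
  rw [NeWord.prod, hw]
  exact Word.equiv.symm_apply_apply x

/-- Every element is the product of a reduced word not ending in the factor `j` and an element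
of that factor. -/
theorem exists_eq_prod_mul_of (j : ι) (x : CoprodI M) :
    ∃ b : M j, x = of b ∨ ∃ k l, l ≠ j ∧ ∃ w : NeWord M k l, x = w.prod * of b := by
  by_cases hx : x = 1
  · exact ⟨1, .inl (by rw [hx, map_one])⟩
  obtain ⟨k, l, w, rfl⟩ := exists_neWord_prod_eq hx
  by_cases hl : l = j
  · subst hl
    obtain ⟨b, ⟨_, hb⟩ | ⟨m, hm, w', hw'⟩⟩ := w.exists_prod_eq_mul_of
    · exact ⟨b, .inl hb⟩
    · exact ⟨b, .inr ⟨k, m, hm, w', hw'⟩⟩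
  · exact ⟨1, .inr ⟨k, l, hl, w, by rw [map_one, mul_one]⟩⟩

/-- A representative of the double coset of `x` with respect to two factors. -/
theorem exists_eq_of_mul_prod_mul_of (i j : ι) (x : CoprodI M) :
    ∃ (a : M i) (b : M j), x = of a * of b ∨
      ∃ k l, k ≠ i ∧ l ≠ j ∧ ∃ w : NeWord M k l, x = of a * w.prod * of b := by
  obtain ⟨b, hb | ⟨k, l, hl, w, hw⟩⟩ := exists_eq_prod_mul_of j x
  · exact ⟨1, b, .inl (by rw [hb, map_one, one_mul])⟩
  by_cases hk : k = i
  · subst hk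
    obtain ⟨a, ⟨_, ha⟩ | ⟨m, hm, w', hw'⟩⟩ := w.exists_prod_eq_of_mul
    · exact ⟨a, b, .inl (by rw [hw, ha])⟩
    · exact ⟨a, b, .inr ⟨m, l, hm, hl, w', by rw [hw, hw']⟩⟩
  · exact ⟨1, b, .inr ⟨k, l, hk, hl, w, by rw [hw, map_one, one_mul]⟩⟩

/-- An element of a free product of a family of groups is elliptic if it is conjugate into one
of the factors. -/
def IsElliptic (x : CoprodI M) : Prop :=
  ∃ (c : CoprodI M) (i : ι) (a : M i), x = c * of a * c⁻¹

theorem IsElliptic.conj {x : CoprodI M} (hx : IsElliptic x) (d : CoprodI M) :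
    IsElliptic (d⁻¹ * x * d) := by
  obtain ⟨c, i, a, rfl⟩ := hx
  exact ⟨d⁻¹ * c, i, a, by group⟩

/-- The reduced word of a nontrivial elliptic element begins and ends in the same factor. -/
theorem IsElliptic.exists_neWord {x : CoprodI M} (hx : IsElliptic x) (hx1 : x ≠ 1) :
    ∃ (k : ι) (w : NeWord M k k), w.prod = x := by
  obtain ⟨c, i, a, rfl⟩ := hx
  have ha : a ≠ 1 := by
    rintro rfl
    simp at hx1
  obtain ⟨b, hb | ⟨k, l, hl, w, hw⟩⟩ := exists_eq_prod_mul_of i c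
  · have hab : b * a * b⁻¹ ≠ 1 := by simpa using ha
    exact ⟨i, .singleton _ hab, by rw [NeWord.prod_singleton, hb]; simp⟩
  · have hab : b * a * b⁻¹ ≠ 1 := by simpa using ha
    refine ⟨k, .append (.append w hl (.singleton _ hab)) hl.symm w.inv, ?_⟩
    rw [NeWord.append_prod, NeWord.append_prod, NeWord.prod_singleton, NeWord.inv_prod, hw]
    simp only [map_mul, map_inv]
    group

theorem NeWord.not_isElliptic_prod {i j : ι} (w : NeWord M i j) (hij : i ≠ j) :
    ¬ IsElliptic w.prod := by
  intro h
  obtain ⟨k, w', hw'⟩ := h.exists_neWord w.prod_ne_one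
  obtain ⟨rfl, rfl⟩ := NeWord.index_eq_of_prod_eq hw'
  exact hij rfl

theorem exists_eq_of_of_isElliptic_mul {i : ι} {a : M i} (ha : a ≠ 1) {y : CoprodI M}
    (hy1 : y ≠ 1) (hy : IsElliptic y) (hay : IsElliptic (of a * y)) : ∃ b : M i, y = of b := by
  obtain ⟨d, j, b, rfl⟩ := hy
  have hb : b ≠ 1 := by
    rintro rfl
    simp at hy1
  obtain ⟨p, q, hd⟩ := exists_eq_of_mul_prod_mul_of i j d
  have ha' : p⁻¹ * a * p ≠ 1 := by
    simpa [mul_assoc, inv_mul_eq_one, eq_comm] using ha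
  have hb' : q * b * q⁻¹ ≠ 1 := by simpa using hb
  have hay' := hay.conj (of p)
  obtain hd | ⟨k, l, hk, hl, w, hd⟩ := hd
  · by_cases hij : i = j
    · subst hij
      exact ⟨p * q * b * (p * q)⁻¹, by rw [hd]; simp only [map_mul, map_inv]⟩
    · refine absurd ?_ (NeWord.not_isElliptic_prod
        (.append (.singleton _ ha') hij (.singleton _ hb')) hij)
      convert hay' using 1
      rw [NeWord.append_prod, NeWord.prod_singleton, NeWord.prod_singleton, hd]
      simp only [map_mul, map_inv]
      group
  · refine absurd ?_ (NeWord.not_isElliptic_prod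
      (.append (.append (.append (.singleton _ ha') hk.symm w) hl (.singleton _ hb')) hl.symm
        w.inv) hk.symm)
    convert hay' using 1
    rw [NeWord.append_prod, NeWord.append_prod, NeWord.append_prod, NeWord.prod_singleton,
      NeWord.prod_singleton, NeWord.inv_prod, hd]
    simp only [map_mul, map_inv]
    group

/-- If two nontrivial elements of a free product and their product are elliptic, then the two
elements lie in a common conjugate of a factor. -/
theorem exists_eq_conj_of_isElliptic_mul {c : CoprodI M} {i : ι} {a : M i}
    (hx1 : c * of a * c⁻¹ ≠ 1) {y : CoprodI M} (hy : IsElliptic y)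
    (hxy : IsElliptic (c * of a * c⁻¹ * y)) : ∃ b : M i, y = c * of b * c⁻¹ := by
  by_cases hy1 : y = 1
  · exact ⟨1, by simp [hy1]⟩
  have ha : a ≠ 1 := by
    rintro rfl
    simp at hx1
  have hy1' : c⁻¹ * y * c ≠ 1 := by
    simpa [mul_assoc, inv_mul_eq_one, eq_comm] using hy1
  have hxy' : IsElliptic (of a * (c⁻¹ * y * c)) := by
    convert hxy.conj c using 1
    group
  obtain ⟨b, hb⟩ := exists_eq_of_of_isElliptic_mul ha hy1' (hy.conj c) hxy'
  exact ⟨b, by rw [← hb]; group⟩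

/-- Serre's lemma for free products: a subgroup generated by elliptic elements whose pairwise
products are elliptic lies in a conjugate of a factor. -/
theorem closure_le_conj_range_of [Nonempty ι] {S : Set (CoprodI M)}
    (hS : ∀ s ∈ S, IsElliptic s) (hSS : ∀ s ∈ S, ∀ t ∈ S, IsElliptic (s * t)) :
    ∃ (c : CoprodI M) (i : ι), ∀ x ∈ Subgroup.closure S, ∃ a : M i, x = c * of a * c⁻¹ := by
  suffices ∃ (c : CoprodI M) (i : ι), ∀ s ∈ S, ∃ a : M i, s = c * of a * c⁻¹ by
    obtain ⟨c, i, hc⟩ := this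
    refine ⟨c, i, fun x hx => ?_⟩
    have hle : Subgroup.closure S ≤ ((MulAut.conj c).toMonoidHom.comp (of (i := i))).range :=
      (Subgroup.closure_le _).2 fun s hs => (hc s hs).imp fun a ha => ha.symm
    exact (hle hx).imp fun a ha => ha.symm
  by_cases h1 : ∀ s ∈ S, s = 1
  · exact ⟨1, Classical.arbitrary ι, fun s hs => ⟨1, by simp [h1 s hs]⟩⟩
  push Not at h1
  obtain ⟨s, hs, hs1⟩ := h1
  obtain ⟨c, i, a, rfl⟩ := hS s hs
  exact ⟨c, i, fun t ht => exists_eq_conj_of_isElliptic_mul hs1 (hS t ht) (hSS _ hs t ht)⟩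

end Monoid.CoprodI

namespace Monoid.Coprod

universe u v

/-- Two groups as a family indexed by `Bool`. -/
def BoolFamily (X : Type u) (Y : Type v) : Bool → Type (max u v)
  | true => ULift.{v} X
  | false => ULift.{u} Y

variable (X : Type u) (Y : Type v) [Group X] [Group Y]

instance BoolFamily.instGroup : ∀ i, Group (BoolFamily X Y i)
  | true => inferInstanceAs (Group (ULift.{v} X))
  | false => inferInstanceAs (Group (ULift.{u} Y))

/-- The inclusion of the first group in the `Bool`-indexed free product. -/
def inlBool : X →* CoprodI (BoolFamily X Y) :=
  (CoprodI.of (M := BoolFamily X Y) (i := true)).comp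
    (MulEquiv.ulift.{u, v} (α := X)).symm.toMonoidHom

/-- The inclusion of the second group in the `Bool`-indexed free product. -/
def inrBool : Y →* CoprodI (BoolFamily X Y) :=
  (CoprodI.of (M := BoolFamily X Y) (i := false)).comp
    (MulEquiv.ulift.{v, u} (α := Y)).symm.toMonoidHom

/-- The factors of the `Bool`-indexed free product, mapped to the binary free product. -/
def ofBool : ∀ i, BoolFamily X Y i →* Coprod X Y
  | true => inl.comp (MulEquiv.ulift.{u, v} (α := X)).toMonoidHom
  | false => inr.comp (MulEquiv.ulift.{v, u} (α := Y)).toMonoidHom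

/-- The binary free product as a free product indexed by `Bool`. -/
def equivCoprodI : Coprod X Y ≃* CoprodI (BoolFamily X Y) :=
  MonoidHom.toMulEquiv (lift (inlBool X Y) (inrBool X Y)) (CoprodI.lift (ofBool X Y))
    (by
      apply hom_ext
      · ext x
        exact CoprodI.lift_of (ofBool X Y) (i := true) _
      · ext y
        exact CoprodI.lift_of (ofBool X Y) (i := false) _)
    (by
      apply CoprodI.ext_hom
      rintro (_ | _)
      · ext y
        simp only [MonoidHom.comp_apply, CoprodI.lift_of]
        rfl
      · ext x
        simp only [MonoidHom.comp_apply, CoprodI.lift_of]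
        rfl)

variable {X Y}

theorem isElliptic_equivCoprodI {x : Coprod X Y} (hx : IsElliptic x) :
    CoprodI.IsElliptic (equivCoprodI X Y x) := by
  obtain ⟨c, ⟨a, rfl⟩ | ⟨b, rfl⟩⟩ := hx
  · exact ⟨equivCoprodI X Y c, true, ⟨a⟩, by rw [map_mul, map_mul, map_inv]; rfl⟩
  · exact ⟨equivCoprodI X Y c, false, ⟨b⟩, by rw [map_mul, map_mul, map_inv]; rfl⟩

theorem equivCoprodI_symm_of (i : Bool) (a : BoolFamily X Y i) :
    (equivCoprodI X Y).symm (CoprodI.of a) = ofBool X Y i a :=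
  CoprodI.lift_of (ofBool X Y) a

/-- Serre's lemma for the free product of two groups. -/
theorem closure_le_conj_range {S : Set (Coprod X Y)} (hS : ∀ s ∈ S, IsElliptic s)
    (hSS : ∀ s ∈ S, ∀ t ∈ S, IsElliptic (s * t)) :
    ∃ c : Coprod X Y, (∀ x ∈ Subgroup.closure S, ∃ a : X, x = c * inl a * c⁻¹) ∨
      (∀ x ∈ Subgroup.closure S, ∃ b : Y, x = c * inr b * c⁻¹) := by
  let e := equivCoprodI X Y
  obtain ⟨c, i, hc⟩ := CoprodI.closure_le_conj_range_of (S := e '' S)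
    (by
      rintro _ ⟨s, hs, rfl⟩
      exact isElliptic_equivCoprodI (hS s hs))
    (by
      rintro _ ⟨s, hs, rfl⟩ _ ⟨t, ht, rfl⟩
      rw [← map_mul]
      exact isElliptic_equivCoprodI (hSS s hs t ht))
  have key : ∀ x ∈ Subgroup.closure S, ∃ a : BoolFamily X Y i,
      x = e.symm c * ofBool X Y i a * (e.symm c)⁻¹ := by
    intro x hx
    obtain ⟨a, ha⟩ := hc (e x) (by
      rw [← MulEquiv.coe_toMonoidHom, ← MonoidHom.map_closure]
      exact Subgroup.mem_map_of_mem _ hx)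
    refine ⟨a, ?_⟩
    rw [← e.symm_apply_apply x, ha, map_mul, map_mul, map_inv, equivCoprodI_symm_of]
  refine ⟨e.symm c, ?_⟩
  cases i
  · exact .inr fun x hx => (key x hx).elim fun b hb => ⟨b.down, hb⟩
  · exact .inl fun x hx => (key x hx).elim fun a ha => ⟨a.down, ha⟩

end Monoid.Coprod

/-- If `H` is a finitely generated subgroup of `G` whose image in the limit group `L` over free
products consists of elliptic elements, then for all but finitely many `n` the image `h n (H)`
is contained in a conjugate of the canonical image of `A n` or of the canonical image of `B n`. -/
theorem fg_elliptic_subgroup_eventually_elliptic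
    {G L : Type*} [Group G] [Group.FG G] [Group L] {A B : ℕ → Type*}
    [∀ n, Group (A n)] [∀ n, Group (B n)]
    (h : ∀ n, G →* Monoid.Coprod (A n) (B n)) (hconv : ConvergentSeq h)
    (η : G →* L) (hsurj : Function.Surjective η)
    (hker : ∀ g : G, η g = 1 ↔ ∀ᶠ n in Filter.atTop, h n g = 1)
    (E : Set L)
    (hE : E = {l : L | ∃ g : G, η g = l ∧ ∀ᶠ n in Filter.atTop, IsElliptic (h n g)})
    (H : Subgroup G) (hHfg : H.FG) (hHE : ∀ x ∈ H, η x ∈ E) :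
    ∀ᶠ n in Filter.atTop, ∃ c : Monoid.Coprod (A n) (B n),
      (∀ x ∈ H, ∃ a : A n, h n x = c * Monoid.Coprod.inl a * c⁻¹) ∨
      (∀ x ∈ H, ∃ b : B n, h n x = c * Monoid.Coprod.inr b * c⁻¹) := by
  have hell : ∀ x ∈ H, ∀ᶠ n in Filter.atTop, IsElliptic (h n x) := by
    intro x hx
    have hxE := hHE x hx
    rw [hE] at hxE
    obtain ⟨g, hg, hgell⟩ := hxE
    have hgx : ∀ᶠ n in Filter.atTop, h n (g⁻¹ * x) = 1 := by
      rw [← hker, map_mul, map_inv, hg, inv_mul_cancel]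
    filter_upwards [hgell, hgx] with n hn hn'
    rw [map_mul, map_inv, inv_mul_eq_one] at hn'
    rwa [← hn']
  obtain ⟨S, rfl⟩ := hHfg
  have hmem : ∀ s ∈ S, s ∈ Subgroup.closure (S : Set G) := fun s hs => Subgroup.subset_closure hs
  have h₁ : ∀ᶠ n in Filter.atTop, ∀ s ∈ S, IsElliptic (h n s) :=
    (Filter.eventually_all_finset S).2 fun s hs => hell s (hmem s hs)
  have h₂ : ∀ᶠ n in Filter.atTop, ∀ s ∈ S, ∀ t ∈ S, IsElliptic (h n (s * t)) :=
    (Filter.eventually_all_finset S).2 fun s hs => (Filter.eventually_all_finset S).2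
      fun t ht => hell _ (mul_mem (hmem s hs) (hmem t ht))
  filter_upwards [h₁, h₂] with n hn₁ hn₂
  obtain ⟨c, hc⟩ := Monoid.Coprod.closure_le_conj_range (S := h n '' S)
    (by
      rintro _ ⟨s, hs, rfl⟩
      exact hn₁ s hs)
    (by
      rintro _ ⟨s, hs, rfl⟩ _ ⟨t, ht, rfl⟩
      rw [← map_mul]
      exact hn₂ s hs t ht)
  have himg : ∀ x ∈ Subgroup.closure (S : Set G), h n x ∈ Subgroup.closure (h n '' S) := by
    intro x hx
    rw [← MonoidHom.map_closure]
    exact Subgroup.mem_map_of_mem _ hx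
  exact ⟨c, hc.imp (fun hc x hx => hc _ (himg x hx)) fun hc x hx => hc _ (himg x hx)⟩
end

section
/- Let G be a finitely generated group, let {h_n : G → A_n * B_n} be a convergent sequence of homomorphisms into free products, and let L be the associated limit group over free products with set of elliptics E_L. Let u₁, u₂, u₃ be nontrivial elements of L such that at least one of u₁, u₂, u₃ does not lie in E_L, and suppose u₁u₂ = u₂u₁ and u₁u₃ = u₃u₁. Then none of u₁, u₂, u₃ lies in E_L, and u₂u₃ = u₃u₂. -/
namespace List

variable {α : Type*}

theorem append_flatten_replicate_comm {u x : List α} (h : u ++ x = x ++ u) (m : ℕ) :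
    u ++ (replicate m x).flatten = (replicate m x).flatten ++ u := by
  induction m with
  | zero => simp
  | succ m ih => rw [replicate_succ, flatten_cons, ← append_assoc, h, append_assoc, ih, append_assoc]

theorem prefix_flatten_replicate_of_append_comm {u x : List α} (hx : x ≠ [])
    (h : u ++ x = x ++ u) {m : ℕ} (hm : u.length ≤ m) : u <+: (replicate m x).flatten := by
  refine prefix_of_prefix_length_le (prefix_append u _)
    (append_flatten_replicate_comm h m ▸ prefix_append _ u) ?_
  have := length_pos_iff.2 hx
  simp only [length_flatten, map_replicate, sum_replicate, smul_eq_mul]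
  nlinarith

/-- Two lists of the same length commuting with the same nonempty list are equal. -/
theorem eq_of_append_comm_of_length_eq {u v x : List α} (hx : x ≠ [])
    (hu : u ++ x = x ++ u) (hv : v ++ x = x ++ v) (h : u.length = v.length) : u = v :=
  (prefix_of_prefix_length_le (prefix_flatten_replicate_of_append_comm hx hu le_rfl)
    (prefix_flatten_replicate_of_append_comm hx hv h.ge) h.le).eq_of_length h

theorem append_comm_of_append_comm {u v x : List α} (hx : x ≠ [])
    (hu : u ++ x = x ++ u) (hv : v ++ x = x ++ v) : u ++ v = v ++ u := by
  refine eq_of_append_comm_of_length_eq hx ?_ ?_ (by simp [Nat.add_comm])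
  · rw [append_assoc, hv, ← append_assoc, hu, append_assoc]
  · rw [append_assoc, hu, ← append_assoc, hv, append_assoc]

end List

namespace Monoid.CoprodI

variable {ι : Type*} {M : ι → Type*} [∀ i, Group (M i)]

/-- The element of the free product spelled by a list of letters. -/
def listProd (l : List (Σ i, M i)) : CoprodI M :=
  (l.map fun s => of s.2).prod

@[simp]
theorem listProd_nil : listProd ([] : List (Σ i, M i)) = 1 := rfl

@[simp]
theorem listProd_cons (s : Σ i, M i) (l : List (Σ i, M i)) :
    listProd (s :: l) = of s.2 * listProd l := by
  simp [listProd]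

@[simp]
theorem listProd_append (l₁ l₂ : List (Σ i, M i)) :
    listProd (l₁ ++ l₂) = listProd l₁ * listProd l₂ := by
  simp [listProd]

theorem listProd_flatten_replicate (m : ℕ) (l : List (Σ i, M i)) :
    listProd (List.replicate m l).flatten = listProd l ^ m := by
  induction m with
  | zero => simp
  | succ m ih => simp [List.replicate_succ, ih, pow_succ']

variable [DecidableEq ι] [∀ i, DecidableEq (M i)]

/-- The list of letters of the reduced word representing an element of the free product. -/
def normalForm (x : CoprodI M) : List (Σ i, M i) :=
  (Word.equiv x).toList

@[simp]
theorem listProd_normalForm (x : CoprodI M) : listProd (normalForm x) = x :=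
  Word.equiv.symm_apply_apply x

theorem normalForm_listProd {l : List (Σ i, M i)} (h1 : ∀ s ∈ l, s.2 ≠ 1)
    (hl : l.IsChain fun s t => s.1 ≠ t.1) : normalForm (listProd l) = l :=
  congrArg Word.toList (Word.equiv.apply_symm_apply ⟨l, h1, hl⟩)

theorem length_of_smul_le {i : ι} (a : M i) (w : Word M) :
    (of a • w).toList.length ≤ w.toList.length + 1 ∧
      ((of a • w).toList.length = w.toList.length + 1 → (of a • w).toList = ⟨i, a⟩ :: w.toList) := by
  obtain ⟨p, rfl⟩ := (Word.equivPair i).symm.surjective w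
  rw [Word.of_smul_def, Equiv.apply_symm_apply, Word.equivPair_symm]
  by_cases hp : p.head = 1 <;> by_cases ha : a * p.head = 1 <;>
    (simp_all [Word.rcons, Word.cons]; try omega)

theorem length_listProd_smul_le (l : List (Σ i, M i)) (w : Word M) :
    (listProd l • w).toList.length ≤ l.length + w.toList.length ∧
      ((listProd l • w).toList.length = l.length + w.toList.length →
        (listProd l • w).toList = l ++ w.toList) := by
  induction l with
  | nil => simp
  | cons s l ih =>
    rw [listProd_cons, mul_smul, List.length_cons]
    obtain ⟨h₁, h₂⟩ := length_of_smul_le s.2 (listProd l • w)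
    refine ⟨by omega, fun h => ?_⟩
    rw [h₂ (by omega), ih.2 (by omega), List.cons_append]

theorem length_normalForm_listProd_le (l : List (Σ i, M i)) :
    (normalForm (listProd l)).length ≤ l.length :=
  (length_listProd_smul_le l Word.empty).1

theorem normalForm_listProd_of_length_eq {l : List (Σ i, M i)}
    (h : (normalForm (listProd l)).length = l.length) : normalForm (listProd l) = l :=
  ((length_listProd_smul_le l Word.empty).2 h).trans (List.append_nil l)

theorem length_normalForm_mul_le (x y : CoprodI M) :
    (normalForm (x * y)).length ≤ (normalForm x).length + (normalForm y).length := by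
  simpa using length_normalForm_listProd_le (normalForm x ++ normalForm y)

theorem normalForm_mul_of_length_eq {x y : CoprodI M}
    (h : (normalForm (x * y)).length = (normalForm x).length + (normalForm y).length) :
    normalForm (x * y) = normalForm x ++ normalForm y := by
  simpa using normalForm_listProd_of_length_eq (l := normalForm x ++ normalForm y) (by simpa using h)

/-- If the powers of `x` are reduced as written, then some translate `x ^ m * y` of an element `y`
of the centralizer of `x` has a normal form commuting with that of `x`. -/
theorem exists_normalForm_append_comm {x y : CoprodI M}
    (hx : ∀ m : ℕ, (normalForm (x ^ m)).length = m * (normalForm x).length) (hy : Commute x y) :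
    ∃ m : ℕ, normalForm (x ^ m * y) ++ normalForm x = normalForm x ++ normalForm (x ^ m * y) := by
  obtain ⟨m, hm⟩ : ∃ m : ℕ, (normalForm (x * (x ^ m * y))).length =
      (normalForm x).length + (normalForm (x ^ m * y)).length := by
    by_contra! H
    have key : ∀ m : ℕ, (normalForm (x ^ m * y)).length + m ≤
        m * (normalForm x).length + (normalForm y).length := by
      intro m
      induction m with
      | zero => simp
      | succ m ih =>
        have h₁ := length_normalForm_mul_le x (x ^ m * y)
        have h₂ := H m
        rw [pow_succ', mul_assoc, Nat.succ_mul]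
        omega
    have h₁ := key ((normalForm y).length + (normalForm y⁻¹).length + 1)
    have h₂ := length_normalForm_mul_le
      (x ^ ((normalForm y).length + (normalForm y⁻¹).length + 1) * y) y⁻¹
    rw [mul_inv_cancel_right, hx] at h₂
    omega
  have hc : x * (x ^ m * y) = x ^ m * y * x :=
    ((Commute.refl x).pow_right m |>.mul_right hy).eq
  refine ⟨m, ?_⟩
  rw [← normalForm_mul_of_length_eq hm, hc,
    normalForm_mul_of_length_eq (x := x ^ m * y) (by rw [← hc, hm, add_comm])]

theorem commute_of_commute_of_length_pow {x y z : CoprodI M} (hx1 : x ≠ 1)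
    (hx : ∀ m : ℕ, (normalForm (x ^ m)).length = m * (normalForm x).length)
    (hy : Commute x y) (hz : Commute x z) : Commute y z := by
  obtain ⟨m, hm⟩ := exists_normalForm_append_comm hx hy
  obtain ⟨n, hn⟩ := exists_normalForm_append_comm hx hz
  have hne : normalForm x ≠ [] := fun h => hx1 (by simpa [h] using (listProd_normalForm x).symm)
  have h := congrArg listProd (List.append_comm_of_append_comm hne hm hn)
  simp only [listProd_append, listProd_normalForm] at h
  have h' : Commute (x ^ m * y) (x ^ n * z) := h
  have hxz : Commute x (x ^ n * z) := ((Commute.refl x).pow_right n).mul_right hz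
  have h₁ : Commute y (x ^ n * z) := by
    simpa using ((hxz.pow_left m).inv_left).mul_left h'
  simpa using ((hy.symm.pow_right n).inv_right).mul_right h₁

/-- An element that is shortest in its conjugacy class and not conjugate into a factor is cyclically
reduced. -/
theorem length_normalForm_pow_of_forall_conj {x : CoprodI M} (hx1 : x ≠ 1)
    (hx : ∀ (c : CoprodI M) (i : ι) (a : M i), x ≠ c * of a * c⁻¹)
    (hmin : ∀ c : CoprodI M, (normalForm x).length ≤ (normalForm (c * x * c⁻¹)).length) (m : ℕ) :
    (normalForm (x ^ m)).length = m * (normalForm x).length := by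
  have hends : ∀ s ∈ (normalForm x).getLast?, ∀ t ∈ (normalForm x).head?, s.1 ≠ t.1 := by
    intro s hs t ht hst
    obtain ⟨l, hl⟩ := List.head?_eq_some_iff.1 ht
    obtain rfl | ⟨l', s', rfl⟩ := l.eq_nil_or_concat
    · exact hx 1 t.1 t.2 (by simpa [hl] using (listProd_normalForm x).symm)
    obtain ⟨i, a⟩ := t
    obtain ⟨j, b⟩ := s
    have hs' : s' = ⟨j, b⟩ := by simpa [hl, List.getLast?_cons] using hs
    subst hs'
    obtain rfl : j = i := hst
    have hprod : (of a)⁻¹ * x * (of a)⁻¹⁻¹ = listProd (l' ++ [⟨j, b * a⟩]) := by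
      rw [← listProd_normalForm x, hl]
      simp [mul_assoc]
    have h₁ := hmin (of a)⁻¹
    rw [hprod, hl] at h₁
    have h₂ := length_normalForm_listProd_le (l' ++ [(⟨j, b * a⟩ : Σ i, M i)])
    simp at h₁ h₂
    omega
  have hne : normalForm x ≠ [] := fun h => hx1 (by simpa [h] using (listProd_normalForm x).symm)
  have hnf : normalForm (x ^ m) = (List.replicate m (normalForm x)).flatten := by
    conv_lhs => rw [← listProd_normalForm x, ← listProd_flatten_replicate]
    refine normalForm_listProd (fun s hs => ?_) ?_
    · obtain ⟨l, hl, hs⟩ := List.mem_flatten.1 hs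
      rw [List.eq_of_mem_replicate hl] at hs
      exact (Word.equiv x).ne_one s hs
    · rw [List.isChain_flatten (fun h => hne (List.eq_of_mem_replicate h).symm)]
      refine ⟨fun l hl => ?_, List.isChain_replicate_of_rel m hends⟩
      rw [List.eq_of_mem_replicate hl]
      exact (Word.equiv x).chain_ne
  rw [hnf]
  simp

/-- Elements not conjugate into a factor have abelian centralizers. -/
theorem commute_of_commute_of_forall_ne_conj {x y z : CoprodI M} (hx1 : x ≠ 1)
    (hx : ∀ (c : CoprodI M) (i : ι) (a : M i), x ≠ c * of a * c⁻¹)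
    (hy : Commute x y) (hz : Commute x z) : Commute y z := by
  obtain ⟨c, hc⟩ : ∃ c : CoprodI M, ∀ d : CoprodI M,
      (normalForm (c * x * c⁻¹)).length ≤ (normalForm (d * x * d⁻¹)).length :=
    ⟨_, fun d => Function.argmin_le (fun c => (normalForm (c * x * c⁻¹)).length) d⟩
  have hpow := length_normalForm_pow_of_forall_conj (x := c * x * c⁻¹)
    (by simpa using hx1)
    (fun d i a h => hx (c⁻¹ * d) i a (by
      rw [mul_inv_rev, inv_inv, mul_assoc, mul_assoc, ← mul_assoc (of a), ← mul_assoc d,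
        ← mul_assoc d, ← h]
      group))
    (fun d => by simpa [mul_assoc] using hc (d * c))
  have h := commute_of_commute_of_length_pow (by simpa using hx1) hpow
    ((Commute.conj_iff c).2 hy) ((Commute.conj_iff c).2 hz)
  exact (Commute.conj_iff c).1 h

/-- The centralizer of a nontrivial element of a factor lies in that factor. -/
theorem exists_eq_of_of_commute {i : ι} {a : M i} (ha : a ≠ 1) {x : CoprodI M}
    (h : Commute (of a) x) : ∃ b : M i, x = of b := by
  obtain ⟨p, hp⟩ : ∃ p : Word.Pair M i, Word.equivPair i (Word.equiv x) = p := ⟨_, rfl⟩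
  obtain ⟨b, t, ht⟩ := p
  have hx : x = of b * listProd t.toList := by
    rw [← listProd_normalForm x, normalForm, ← Equiv.symm_apply_apply (Word.equivPair i)
      (Word.equiv x), hp, Word.equivPair_symm]
    exact Word.prod_rcons _
  suffices t.toList = [] from ⟨b, by simpa [this] using hx⟩
  have hc : listProd (⟨i, b⁻¹ * a * b⟩ :: t.toList) = listProd (t.toList ++ [⟨i, a⟩]) := by
    have := h.eq
    rw [hx] at this
    simp only [listProd_cons, listProd_append, listProd_nil, map_mul, map_inv, mul_one, mul_assoc]
    rw [this]
    simp [mul_assoc]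
  have hl : normalForm (listProd (⟨i, b⁻¹ * a * b⟩ :: t.toList)) = ⟨i, b⁻¹ * a * b⟩ :: t.toList :=
    congrArg Word.toList (Word.equiv.apply_symm_apply
      (Word.cons (b⁻¹ * a * b) t ht (by simpa [mul_assoc, inv_mul_eq_one, eq_comm] using ha)))
  have hr : normalForm (listProd (t.toList ++ [⟨i, a⟩])) = t.toList ++ [⟨i, a⟩] :=
    normalForm_listProd_of_length_eq (by rw [← hc, hl]; simp)
  rw [← hc, hl] at hr
  rcases hs : t.toList with _ | ⟨s, l⟩
  · rfl
  · rw [hs] at hr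
    exact (Word.fstIdx_ne_iff.1 ht s (by simp [hs]) (congrArg Sigma.fst (List.cons.inj hr).1)).elim

end Monoid.CoprodI

namespace Monoid.Coprod

universe u v

/-- The two factors of a free product, as a family of groups in a common universe. -/
def Factor (X : Type u) (Y : Type v) : Bool → Type max u v
  | false => ULift.{v} X
  | true => ULift.{u} Y

instance (X : Type u) (Y : Type v) [Group X] [Group Y] : ∀ b, Group (Factor X Y b)
  | false => inferInstanceAs (Group (ULift.{v} X))
  | true => inferInstanceAs (Group (ULift.{u} Y))

variable {X : Type u} {Y : Type v} [Group X] [Group Y]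

/-- The comparison map from the binary free product to the indexed free product. -/
def toCoprodI : Coprod X Y →* CoprodI (Factor X Y) :=
  lift
    ((CoprodI.of (M := Factor X Y) (i := false)).comp
      (MulEquiv.ulift.symm : X ≃* ULift.{v} X).toMonoidHom)
    ((CoprodI.of (M := Factor X Y) (i := true)).comp
      (MulEquiv.ulift.symm : Y ≃* ULift.{u} Y).toMonoidHom)

/-- The comparison map from the indexed free product to the binary free product. -/
def ofCoprodI : CoprodI (Factor X Y) →* Coprod X Y :=
  CoprodI.lift fun b => match b with
    | false => inl.comp (MulEquiv.ulift : ULift.{v} X ≃* X).toMonoidHom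
    | true => inr.comp (MulEquiv.ulift : ULift.{u} Y ≃* Y).toMonoidHom

theorem ofCoprodI_of_false (a : Factor X Y false) :
    ofCoprodI (CoprodI.of a) = inl (ULift.down.{v} (α := X) a) :=
  CoprodI.lift_of _ _

theorem ofCoprodI_of_true (a : Factor X Y true) :
    ofCoprodI (CoprodI.of a) = inr (ULift.down.{u} (α := Y) a) :=
  CoprodI.lift_of _ _

theorem toCoprodI_inl (a : X) :
    toCoprodI (inl a : Coprod X Y) =
      CoprodI.of (M := Factor X Y) (i := false) (ULift.up.{v} a) :=
  rfl

theorem toCoprodI_inr (b : Y) :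
    toCoprodI (inr b : Coprod X Y) =
      CoprodI.of (M := Factor X Y) (i := true) (ULift.up.{u} b) :=
  rfl

@[simp]
theorem ofCoprodI_toCoprodI (x : Coprod X Y) : ofCoprodI (toCoprodI x) = x := by
  have h : (ofCoprodI (X := X) (Y := Y)).comp toCoprodI = .id _ := by
    ext a
    · exact ofCoprodI_of_false _
    · exact ofCoprodI_of_true _
  exact DFunLike.congr_fun h x

theorem isElliptic_ofCoprodI_of {i : Bool} (a : Factor X Y i) :
    IsElliptic (ofCoprodI (CoprodI.of a)) := by
  cases i
  · exact ⟨1, .inl ⟨_, by simpa using ofCoprodI_of_false a⟩⟩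
  · exact ⟨1, .inr ⟨_, by simpa using ofCoprodI_of_true a⟩⟩

end Monoid.Coprod

section IsElliptic

open Monoid.Coprod

variable {X Y : Type*} [Group X] [Group Y] {x y z : Monoid.Coprod X Y}

theorem IsElliptic.conj (hx : IsElliptic x) (d : Monoid.Coprod X Y) :
    IsElliptic (d * x * d⁻¹) := by
  obtain ⟨c, ⟨a, rfl⟩ | ⟨b, rfl⟩⟩ := hx
  · exact ⟨d * c, .inl ⟨a, by group⟩⟩
  · exact ⟨d * c, .inr ⟨b, by group⟩⟩

theorem isElliptic_one : IsElliptic (1 : Monoid.Coprod X Y) :=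
  ⟨1, .inl ⟨1, by simp⟩⟩

/-- A non-elliptic element of a free product has abelian centralizer. -/
theorem commute_of_commute_of_not_isElliptic (hx : ¬ IsElliptic x) (hy : Commute x y)
    (hz : Commute x z) : Commute y z := by
  classical
  have h := Monoid.CoprodI.commute_of_commute_of_forall_ne_conj (x := toCoprodI x)
    (fun h => hx (by
      rw [← ofCoprodI_toCoprodI x, h, map_one]
      exact isElliptic_one))
    (fun c i a h => hx (by
      rw [← ofCoprodI_toCoprodI x, h, map_mul, map_mul, map_inv]
      exact (isElliptic_ofCoprodI_of a).conj _))
    (hy.map toCoprodI) (hz.map toCoprodI)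
  simpa using h.map ofCoprodI

/-- In a free product, the elements commuting with a nontrivial elliptic element are elliptic. -/
theorem IsElliptic.of_commute (hx : IsElliptic x) (hx1 : x ≠ 1) (hy : Commute x y) :
    IsElliptic y := by
  classical
  have key : ∀ {c : Monoid.Coprod X Y} {i : Bool} {a : Factor X Y i}, a ≠ 1 →
      Commute (Monoid.CoprodI.of a) (toCoprodI (c⁻¹ * y * c)) → IsElliptic y := by
    intro c i a ha h
    obtain ⟨b, hb⟩ := Monoid.CoprodI.exists_eq_of_of_commute ha h
    have h' := (isElliptic_ofCoprodI_of b).conj c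
    rw [← hb, ofCoprodI_toCoprodI] at h'
    simpa [mul_assoc] using h'
  obtain ⟨c, ⟨a, rfl⟩ | ⟨b, rfl⟩⟩ := hx
  · refine key (c := c) (i := false) (a := ULift.up a) (fun h => hx1 ?_) ?_
    · simp [show a = 1 from congrArg ULift.down h]
    · rw [← toCoprodI_inl]
      refine Commute.map ?_ toCoprodI
      simpa [mul_assoc] using (Commute.conj_iff c⁻¹).2 hy
  · refine key (c := c) (i := true) (a := ULift.up b) (fun h => hx1 ?_) ?_
    · simp [show b = 1 from congrArg ULift.down h]
    · rw [← toCoprodI_inr]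
      refine Commute.map ?_ toCoprodI
      simpa [mul_assoc] using (Commute.conj_iff c⁻¹).2 hy

end IsElliptic

/-- Commutation transitivity in a limit group over free products: if `u₁, u₂, u₃` are
nontrivial, at least one of them is non-elliptic, and `u₁` commutes with `u₂` and with `u₃`,
then all three are non-elliptic and `u₂` commutes with `u₃`. -/
theorem commute_of_commute_nonelliptic
    {G L : Type*} [Group G] [Group.FG G] [Group L] {A B : ℕ → Type*}
    [∀ n, Group (A n)] [∀ n, Group (B n)]
    (h : ∀ n, G →* Monoid.Coprod (A n) (B n)) (hconv : ConvergentSeq h)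
    (η : G →* L) (hsurj : Function.Surjective η)
    (hker : ∀ g : G, η g = 1 ↔ ∀ᶠ n in Filter.atTop, h n g = 1)
    (E : Set L)
    (hE : E = {l : L | ∃ g : G, η g = l ∧ ∀ᶠ n in Filter.atTop, IsElliptic (h n g)})
    (u₁ u₂ u₃ : L) (h₁ : u₁ ≠ 1) (h₂ : u₂ ≠ 1) (h₃ : u₃ ≠ 1)
    (hne : u₁ ∉ E ∨ u₂ ∉ E ∨ u₃ ∉ E)
    (c₁₂ : Commute u₁ u₂) (c₁₃ : Commute u₁ u₃) :
    u₁ ∉ E ∧ u₂ ∉ E ∧ u₃ ∉ E ∧ Commute u₂ u₃ := by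
  subst hE
  obtain ⟨g₁, rfl⟩ := hsurj u₁
  obtain ⟨g₂, rfl⟩ := hsurj u₂
  obtain ⟨g₃, rfl⟩ := hsurj u₃
  have hmem : ∀ g : G, η g ∉ {l : L | ∃ g : G, η g = l ∧ ∀ᶠ n in Filter.atTop,
      IsElliptic (h n g)} ↔ ∀ᶠ n in Filter.atTop, ¬ IsElliptic (h n g) := by
    intro g
    refine ⟨fun hg => (hconv.2 g).resolve_left fun H => hg ⟨g, rfl, H⟩, ?_⟩
    rintro hg ⟨g', hgg', hg'⟩
    have hk := (hker (g'⁻¹ * g)).1 (by simp [hgg'])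
    obtain ⟨n, hn, hn', hnk⟩ := (hg.and (hg'.and hk)).exists
    rw [map_mul, map_inv, inv_mul_eq_one] at hnk
    exact hn (hnk ▸ hn')
  have hone : ∀ g : G, η g ≠ 1 → ∀ᶠ n in Filter.atTop, h n g ≠ 1 :=
    fun g hg => (hconv.1 g).resolve_left fun H => hg ((hker g).2 H)
  have hcomm : ∀ a b : G, Commute (η a) (η b) ↔
      ∀ᶠ n in Filter.atTop, Commute (h n a) (h n b) := by
    intro a b
    have := hker (a * b * (b * a)⁻¹)
    simp only [map_mul, map_inv, mul_inv_eq_one] at this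
    exact this
  simp only [hmem] at hne ⊢
  have trans : ∀ a b : G, η b ≠ 1 → Commute (η a) (η b) →
      (∀ᶠ n in Filter.atTop, ¬ IsElliptic (h n a)) →
      ∀ᶠ n in Filter.atTop, ¬ IsElliptic (h n b) := by
    intro a b hb hab ha
    filter_upwards [hone b hb, (hcomm a b).1 hab, ha] with n h1 h2 h3 h4
    exact h3 (h4.of_commute h1 h2.symm)
  have hn₁ : ∀ᶠ n in Filter.atTop, ¬ IsElliptic (h n g₁) := by
    obtain hn | hn | hn := hne
    · exact hn
    · exact trans g₂ g₁ h₁ c₁₂.symm hn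
    · exact trans g₃ g₁ h₁ c₁₃.symm hn
  refine ⟨hn₁, trans g₁ g₂ h₂ c₁₂ hn₁, trans g₁ g₃ h₃ c₁₃ hn₁, (hcomm g₂ g₃).2 ?_⟩
  filter_upwards [hn₁, (hcomm g₁ g₂).1 c₁₂, (hcomm g₁ g₃).1 c₁₃] with n hn hn₂ hn₃
  exact commute_of_commute_of_not_isElliptic hn hn₂ hn₃
end

section
/- Let G be a finitely generated group and let N₁ ⊆ N₂ ⊆ N₃ ⊆ ⋯ be a strictly increasing sequence of normal subgroups of G (N_i ≠ N_{i+1} for every i). Let N = ⋃_i N_i. Then the quotient group G/N is not finitely presented. -/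
universe u

/-- A group is finitely presented if it is isomorphic to the quotient of a finitely generated
free group by the normal closure of a finite set of relations. -/
def IsFinitelyPresented (G : Type u) [Group G] : Prop :=
  ∃ (n : ℕ) (rels : Set (FreeGroup (Fin n))), rels.Finite ∧
    Nonempty (PresentedGroup rels ≃* G)

/-- If the quotient of a finitely generated group by a normal subgroup `K` is finitely presented,
then `K` is the normal closure of a finite set. -/
theorem IsFinitelyPresented.isFinitelyNormallyGenerated_of_quotient {G : Type u} [Group G] [Group.FG G]
    (K : Subgroup G) [K.Normal] (h : IsFinitelyPresented (G ⧸ K)) :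
    K.IsFinitelyNormallyGenerated := by
  obtain ⟨n, rels, hfin, ⟨e⟩⟩ := h
  obtain ⟨S, hS⟩ := Group.fg_def.mp (inferInstance : Group.FG G)
  let π : FreeGroup (Fin n) →* G ⧸ K := e.toMonoidHom.comp (PresentedGroup.mk rels)
  have hπ_surj : Function.Surjective π :=
    e.surjective.comp (PresentedGroup.mk_surjective rels)
  have hπ_one (w : FreeGroup (Fin n)) : π w = 1 ↔ w ∈ Subgroup.normalClosure rels :=
    (map_eq_one_iff e e.injective).trans PresentedGroup.mk_eq_one_iff
  choose g hg using fun a : Fin n ↦ QuotientGroup.mk'_surjective K (π (FreeGroup.of a))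
  let φ : FreeGroup (Fin n) →* G := FreeGroup.lift g
  have hφ (w : FreeGroup (Fin n)) : (φ w : G ⧸ K) = π w := by
    have : (QuotientGroup.mk' K).comp φ = π := FreeGroup.ext_hom _ _ (by simpa [φ] using hg)
    exact DFunLike.congr_fun this w
  choose w hw using fun s : G ↦ hπ_surj (s : G ⧸ K)
  let T : Set G := φ '' rels ∪ (fun s ↦ (φ (w s))⁻¹ * s) '' (S : Set G)
  have hTK : Subgroup.normalClosure T ≤ K := by
    refine Subgroup.normalClosure_le_normal ?_
    rintro _ (⟨r, hr, rfl⟩ | ⟨s, -, rfl⟩)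
    · exact (QuotientGroup.eq_one_iff _).mp
        ((hφ r).trans ((hπ_one r).mpr (Subgroup.subset_normalClosure hr)))
    · exact QuotientGroup.eq.mp ((hφ _).trans (hw s))
  have hrels : Subgroup.normalClosure rels ≤ (Subgroup.normalClosure T).comap φ :=
    Subgroup.normalClosure_le_normal fun r hr ↦
      Subgroup.subset_normalClosure (Or.inl ⟨r, hr, rfl⟩)
  have htop : φ.range ⊔ Subgroup.normalClosure T = ⊤ := by
    rw [eq_top_iff, ← hS, Subgroup.closure_le]
    intro s hs
    have h₂ : (φ (w s))⁻¹ * s ∈ Subgroup.normalClosure T :=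
      Subgroup.subset_normalClosure (Or.inr ⟨s, hs, rfl⟩)
    simpa using Subgroup.mul_mem_sup (φ.mem_range.mpr ⟨w s, rfl⟩) h₂
  refine ⟨T, (hfin.image _).union (S.finite_toSet.image _), le_antisymm hTK fun k hk ↦ ?_⟩
  obtain ⟨_, ⟨v, rfl⟩, m, hm, rfl⟩ :=
    Subgroup.mem_sup_of_normal_right.mp (htop ▸ Subgroup.mem_top k)
  refine mul_mem (hrels ((hπ_one v).mp ?_)) hm
  rw [← hφ, QuotientGroup.eq_one_iff]
  exact (K.mul_mem_cancel_right (hTK hm)).mp hk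

/-- Lemma 14(i): if `G` is a finitely generated group and `N₁ ⊆ N₂ ⊆ ⋯` is a strictly
increasing sequence of normal subgroups of `G` with union `K`, then the quotient `G ⧸ K` is
not finitely presented. -/
theorem quotient_by_union_of_strictly_increasing_chain_not_finitely_presented
    {G : Type u} [Group G] [Group.FG G] (N : ℕ → Subgroup G)
    (hnorm : ∀ i, (N i).Normal)
    (hmono : ∀ i, N i ≤ N (i + 1))
    (hstrict : ∀ i, N i ≠ N (i + 1))
    (K : Subgroup G) [K.Normal]
    (hK : (K : Set G) = ⋃ i, (N i : Set G)) :
    ¬ IsFinitelyPresented (G ⧸ K) := by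
  intro h
  obtain ⟨T, hTfin, hTK⟩ := h.isFinitelyNormallyGenerated_of_quotient
  have hN : Monotone N := monotone_nat_of_le_succ hmono
  have hTN : T ⊆ ⋃ i, (N i : Set G) := hK ▸ hTK ▸ Subgroup.subset_normalClosure
  obtain ⟨i, hi⟩ :=
    hN.directed_le.exists_mem_subset_of_finset_subset_biUnion (f := fun i ↦ (N i : Set G))
      (s := hTfin.toFinset) (by simpa using hTN)
  rw [hTfin.coe_toFinset] at hi
  have := hnorm i
  have hKi : K ≤ N i := hTK ▸ Subgroup.normalClosure_le_normal hi
  have hle : N (i + 1) ≤ K := fun x hx ↦ by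
    rw [← SetLike.mem_coe, hK]
    exact Set.mem_iUnion_of_mem (i + 1) hx
  exact hstrict i (le_antisymm (hmono i) (hle.trans hKi))
end
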